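/- Let X be a locally connected Hausdorff space, C a closed solid subset of X, and V an open set with C ⊆ V. Then C is a solid subset of the space V equipped with the subspace topology; that is, every connected component of V ∖ C has closure in V that is not compact. -/

import Mathlib

open Set

/-- `C` is a connected component of the set `S` (in the ambient space `X`). -/
def IsCompOf {X : Type*} [TopologicalSpace X] (C S : Set X) : Prop :=
  ∃ x ∈ S, C = connectedComponentIn S x

/-- A set is solid if it is connected and every connected component of its complement is
unbounded (has non-compact closure). -/
def Solid {X : Type*} [TopologicalSpace X] (A : Set X) : Prop :=
  IsConnected A ∧ ∀ C : Set X, IsCompOf C Aᶜ → ¬ IsCompact (closure C)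

/-- A connected component of a set is relatively closed in that set. -/
theorem closure_connectedComponentIn_inter_subset {X : Type*} [TopologicalSpace X] {S : Set X}
    {x : X} (hx : x ∈ S) :
    closure (connectedComponentIn S x) ∩ S ⊆ connectedComponentIn S x :=
  (isPreconnected_connectedComponentIn.subset_closure
    (subset_inter subset_closure (connectedComponentIn_subset S x))
    inter_subset_left).subset_connectedComponentIn
      ⟨subset_closure (mem_connectedComponentIn hx), hx⟩ inter_subset_right

/-- Let `X` be a locally connected Hausdorff space, `C` a closed solid set and `V` open with
`C ⊆ V`. Then `C` is solid in the subspace `V`: every connected component `E` of `V \ C` has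
closure in `V` (which equals `closure E ∩ V`) that is not compact. -/
theorem closed_solid_is_solid_in_open_subspace
    {X : Type*} [TopologicalSpace X] [LocallyConnectedSpace X] [T2Space X]
    (C V : Set X) (hC : IsClosed C) (hCs : Solid C) (hV : IsOpen V) (hCV : C ⊆ V)
    (E : Set X) (hE : IsCompOf E (V \ C)) :
    ¬ IsCompact (closure E ∩ V) := by
  obtain ⟨x, hx, rfl⟩ := hE
  intro hK
  set E := connectedComponentIn (V \ C) x
  have hEV : E ⊆ V := (connectedComponentIn_subset _ x).trans sdiff_subset
  have hclV : closure E ⊆ closure E ∩ V :=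
    hK.isClosed.closure_subset_iff.2 (subset_inter subset_closure hEV)
  refine hCs.2 E ⟨x, hx.2, ?_⟩ (hK.of_isClosed_subset isClosed_closure hclV)
  refine (connectedComponentIn_mono x fun y hy => hy.2).antisymm ?_
  -- `E` is open and relatively closed in the complement of `C`.
  refine isPreconnected_connectedComponentIn.subset_left_of_subset_union
    (hV.sdiff hC).connectedComponentIn isClosed_closure.isOpen_compl
    (disjoint_compl_right.mono_left subset_closure) (fun y hy => ?_)
    ⟨x, mem_connectedComponentIn hx.2, mem_connectedComponentIn hx⟩
  by_cases hyE : y ∈ closure E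
  · exact Or.inl (closure_connectedComponentIn_inter_subset hx
      ⟨hyE, (hclV hyE).2, connectedComponentIn_subset _ x hy⟩)
  · exact Or.inr hyE
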